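/- Let k ≤ n be positive integers. Let Q be a random n × k real matrix distributed according to the Haar probability measure on the Stiefel manifold V_k^n, and let Γ be an n × k random matrix with independent N(0,1) entries. Define α = α(k, n) = (1/k) Σ_{i=1}^k E(X_i), where X_i is the positive square root of a chi-square random variable with n − i + 1 degrees of freedom. Then for every concave function g : M^{n×k} → ℝ, one has E g(Q) ≥ E g(α^{-1} Γ). -/

import Mathlib

open MeasureTheory ProbabilityTheory Matrix

/-- The space of `n × k` real matrices carries the product measurable structure. -/
instance matrixMeasurableSpace (n k : ℕ) : MeasurableSpace (Matrix (Fin n) (Fin k) ℝ) :=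
  MeasurableSpace.pi

/-- The expectation of the positive square root of a chi-square random variable with `p`
degrees of freedom; chi-square with `p` degrees of freedom is the Gamma distribution with
shape `p/2` and rate `1/2`. -/
noncomputable def chiSqrtMoment (p : ℝ) : ℝ :=
  ∫ x, Real.sqrt x ∂(gammaMeasure (p / 2) (1 / 2))

/-- The constant `α(k, n) = (1/k) Σ_{i=1}^k E(X_i)` where `X_i²` is chi-square with
`n - i + 1` degrees of freedom. -/
noncomputable def alphaConst (k n : ℕ) : ℝ :=
  (1 / (k : ℝ)) * ∑ i ∈ Finset.Icc 1 k, chiSqrtMoment ((n : ℝ) - (i : ℝ) + 1)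

section StdGaussian

open Module Set

variable {E : Type*} [NormedAddCommGroup E] [InnerProductSpace ℝ E] [FiniteDimensional ℝ E]
  [MeasurableSpace E] [BorelSpace E]

theorem chiSqrtMoment_eq {p : ℝ} (hp : 0 < p) :
    chiSqrtMoment p =
      (1 / 2 : ℝ) ^ (-(1 / 2) : ℝ) * Real.Gamma ((p + 1) / 2) / Real.Gamma (p / 2) := by
  have h2 : (0 : ℝ) < 1 / 2 := by norm_num
  have hG := (Real.Gamma_pos_of_pos (half_pos hp)).ne'
  unfold chiSqrtMoment gammaMeasure
  rw [integral_withDensity_eq_integral_toReal_smul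
    (f := gammaPDF (p / 2) (1 / 2)) (measurable_gammaPDFReal _ _).ennreal_ofReal
    (by simp [gammaPDF])]
  have hzero : ∀ x ∉ Ioi (0 : ℝ),
      (gammaPDF (p / 2) (1 / 2) x).toReal • Real.sqrt x = 0 := by
    intro x hx
    rw [Real.sqrt_eq_zero_of_nonpos (not_lt.1 hx), smul_zero]
  rw [← setIntegral_eq_integral_of_forall_compl_eq_zero hzero]
  have : ∀ x ∈ Ioi (0 : ℝ), (gammaPDF (p / 2) (1 / 2) x).toReal • Real.sqrt x =
      (1 / 2) ^ (p / 2) / Real.Gamma (p / 2) *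
        (x ^ ((p + 1) / 2 - 1) * Real.exp (-((1 / 2) * x))) := by
    intro x hx
    have hx' : 0 < x := hx
    rw [gammaPDF, ENNReal.toReal_ofReal (gammaPDFReal_nonneg (half_pos hp) h2 x), gammaPDFReal,
      if_pos hx'.le, Real.sqrt_eq_rpow, smul_eq_mul,
      show (p + 1) / 2 - 1 = (p / 2 - 1) + 1 / 2 by ring, Real.rpow_add hx']
    ring
  rw [setIntegral_congr_fun measurableSet_Ioi this, integral_const_mul,
    Real.integral_rpow_mul_exp_neg_mul_Ioi (by positivity) h2]
  rw [show (p + 1) / 2 = p / 2 + 1 / 2 by ring, show (1 : ℝ) / (1 / 2) = (1 / 2)⁻¹ by norm_num,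
    Real.inv_rpow h2.le, Real.rpow_add h2, Real.rpow_neg h2.le]
  have := (Real.rpow_pos_of_pos h2 (p / 2)).ne'
  field_simp

theorem chiSqrtMoment_pos {p : ℝ} (hp : 0 < p) : 0 < chiSqrtMoment p := by
  rw [chiSqrtMoment_eq hp]
  have := Real.Gamma_pos_of_pos (half_pos hp)
  have := Real.Gamma_pos_of_pos (show 0 < (p + 1) / 2 by positivity)
  positivity

variable (E) in
theorem stdGaussian_eq_withDensity :
    stdGaussian E = (volume : Measure E).withDensity fun x ↦
      ENNReal.ofReal ((∫ y : E, Real.exp (-(1 / 2) * ‖y‖ ^ 2))⁻¹ *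
        Real.exp (-(1 / 2) * ‖x‖ ^ 2)) := by
  set C := ∫ y : E, Real.exp (-(1 / 2) * ‖y‖ ^ 2) with hC
  have hint : Integrable fun y : E ↦ Real.exp (-(1 / 2) * ‖y‖ ^ 2) := by
    have := GaussianFourier.integrable_cexp_neg_mul_sq_norm_add (V := E) (b := 1 / 2)
      (by norm_num) 0 0
    refine this.re.congr (.of_forall fun x ↦ ?_)
    simp [← Complex.ofReal_pow, Complex.exp_re]
  have hCpos : 0 < C := by
    rw [hC, GaussianFourier.integral_rexp_neg_mul_sq_norm (by norm_num)]
    positivity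
  have : IsFiniteMeasure ((volume : Measure E).withDensity fun x ↦
      ENNReal.ofReal (C⁻¹ * Real.exp (-(1 / 2) * ‖x‖ ^ 2))) :=
    isFiniteMeasure_withDensity_ofReal (hint.const_mul _).2
  refine Measure.ext_of_charFun ?_
  ext t
  rw [charFun_stdGaussian, charFun_apply, integral_withDensity_eq_integral_toReal_smul
    (by fun_prop) (by simp)]
  have hpt : ∀ x : E, (ENNReal.ofReal (C⁻¹ * Real.exp (-(1 / 2) * ‖x‖ ^ 2))).toReal •
      Complex.exp (inner ℝ x t * Complex.I) =
      (C : ℂ)⁻¹ * Complex.exp (-(1 / 2) * ‖x‖ ^ 2 + Complex.I * inner ℝ t x) := by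
    intro x
    rw [ENNReal.toReal_ofReal (by positivity), Complex.real_smul, Complex.exp_add,
      real_inner_comm]
    push_cast
    ring_nf
  have hCc : (C : ℂ) = ∫ v : E, Complex.exp (-(1 / 2) * ‖v‖ ^ 2) := by
    rw [hC, ← integral_complex_ofReal]
    push_cast
    rfl
  simp_rw [hpt]
  rw [integral_const_mul,
    GaussianFourier.integral_cexp_neg_mul_sq_norm_add (by norm_num) Complex.I t,
    ← GaussianFourier.integral_cexp_neg_mul_sq_norm (by norm_num), ← hCc,
    inv_mul_cancel_left₀ (by exact_mod_cast hCpos.ne')]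
  rw [Complex.I_sq]
  ring_nf

theorem integral_norm_stdGaussian (hE : 0 < finrank ℝ E) :
    ∫ x, ‖x‖ ∂stdGaussian E = chiSqrtMoment (finrank ℝ E) := by
  have : Nontrivial E := finrank_pos_iff.1 hE
  rw [stdGaussian_eq_withDensity, integral_withDensity_eq_integral_toReal_smul
    (by fun_prop) (by simp)]
  set C := ∫ y : E, Real.exp (-(1 / 2) * ‖y‖ ^ 2) with hC
  have hCpos : 0 < C := by
    rw [hC, GaussianFourier.integral_rexp_neg_mul_sq_norm (by norm_num)]
    positivity
  have h1 : ∀ x : E, (ENNReal.ofReal (C⁻¹ * Real.exp (-(1 / 2) * ‖x‖ ^ 2))).toReal • ‖x‖ =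
      C⁻¹ * (‖x‖ * Real.exp (-(1 / 2) * ‖x‖ ^ 2)) := by
    intro x
    rw [ENNReal.toReal_ofReal (by positivity), smul_eq_mul]
    ring
  have hm : 0 < (finrank ℝ E : ℝ) := by exact_mod_cast hE
  have hrad : ∀ q : ℝ, 0 ≤ q → ∫ y in Ioi (0 : ℝ),
      y ^ (finrank ℝ E - 1) • (y ^ q * Real.exp (-(1 / 2) * y ^ 2)) =
      (1 / 2 : ℝ) ^ (-(finrank ℝ E + q) / 2) * (1 / 2) *
        Real.Gamma ((finrank ℝ E + q) / 2) := by
    intro q hq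
    have := integral_rpow_mul_exp_neg_mul_rpow (p := 2) (q := finrank ℝ E - 1 + q) (b := 1 / 2)
      (by norm_num) (by linarith) (by norm_num)
    rw [show (finrank ℝ E : ℝ) - 1 + q + 1 = finrank ℝ E + q by ring] at this
    rw [← this]
    refine setIntegral_congr_fun measurableSet_Ioi fun y hy ↦ ?_
    have hy' : 0 < y := hy
    have hcast : ((finrank ℝ E - 1 : ℕ) : ℝ) = (finrank ℝ E : ℝ) - 1 := by
      rw [Nat.cast_sub hE, Nat.cast_one]
    simp only [smul_eq_mul]
    rw [Real.rpow_add hy', ← hcast, Real.rpow_natCast, Real.rpow_two]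
    ring
  have h0 := integral_fun_norm_addHaar (volume : Measure E) fun y ↦
    y ^ (0 : ℝ) * Real.exp (-(1 / 2) * y ^ 2)
  have h2 := integral_fun_norm_addHaar (volume : Measure E) fun y ↦
    y ^ (1 : ℝ) * Real.exp (-(1 / 2) * y ^ 2)
  rw [hrad _ le_rfl] at h0
  rw [hrad _ zero_le_one] at h2
  simp only [Real.rpow_zero, one_mul, Real.rpow_one, add_zero, ← hC] at h0 h2
  simp_rw [h1]
  rw [integral_const_mul, h2, chiSqrtMoment_eq hm]
  have hh : (0 : ℝ) < 1 / 2 := by norm_num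
  have hG := (Real.Gamma_pos_of_pos (half_pos hm)).ne'
  rw [show -((finrank ℝ E : ℝ) + 1) / 2 = -(finrank ℝ E : ℝ) / 2 + -(1 / 2) by ring,
    Real.rpow_add hh]
  simp only [nsmul_eq_mul, smul_eq_mul] at h0 ⊢
  rw [inv_mul_eq_div, div_eq_div_iff hCpos.ne' hG, h0]
  ring

end StdGaussian

section Projection

variable {E : Type*} [NormedAddCommGroup E] [InnerProductSpace ℝ E] [FiniteDimensional ℝ E]
  [MeasurableSpace E] [BorelSpace E]

theorem stdGaussian_map_orthogonalProjection (W : Submodule ℝ E) :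
    (stdGaussian E).map W.orthogonalProjectionOnto = stdGaussian W := by
  refine Measure.ext_of_charFun ?_
  ext t
  rw [charFun_apply, integral_map (by fun_prop) (by fun_prop), charFun_stdGaussian]
  have : ∀ x : E, inner ℝ (W.orthogonalProjectionOnto x) t = inner ℝ x (t : E) := by
    intro x
    simp
  simp_rw [this]
  rw [← charFun_apply, charFun_stdGaussian, Submodule.coe_norm]

theorem integral_norm_orthogonalProjection_stdGaussian (W : Submodule ℝ E)
    (hW : 0 < Module.finrank ℝ W) :
    ∫ x, ‖W.orthogonalProjectionOnto x‖ ∂stdGaussian E = chiSqrtMoment (Module.finrank ℝ W) := by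
  rw [← integral_norm_stdGaussian hW, ← stdGaussian_map_orthogonalProjection,
    integral_map (by fun_prop) (by fun_prop)]

end Projection

section GaussianMatrix

/-- The law of an `n × k` matrix with independent standard Gaussian entries. -/
noncomputable def gaussianMatrix (n k : ℕ) : Measure (Matrix (Fin n) (Fin k) ℝ) :=
  Measure.pi fun _ : Fin n => Measure.pi fun _ : Fin k => gaussianReal 0 1

instance (n k : ℕ) : IsProbabilityMeasure (gaussianMatrix n k) :=
  inferInstanceAs (IsProbabilityMeasure
    (Measure.pi fun _ : Fin n => Measure.pi fun _ : Fin k => gaussianReal 0 1))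

theorem measurable_matrix_iff {α : Type*} [MeasurableSpace α] {n k : ℕ}
    {f : α → Matrix (Fin n) (Fin k) ℝ} :
    Measurable f ↔ ∀ i j, Measurable fun a ↦ f a i j := by
  constructor
  · intro hf i j
    exact (measurable_pi_apply j).comp ((measurable_pi_apply i).comp hf)
  · intro hf
    exact measurable_pi_lambda _ fun i ↦ measurable_pi_lambda _ fun j ↦ hf i j

theorem measurable_matrix_entry {n k : ℕ} (i : Fin n) (j : Fin k) :
    Measurable fun A : Matrix (Fin n) (Fin k) ℝ ↦ A i j :=
  measurable_matrix_iff.1 measurable_id i j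

theorem Measurable.matrix_mul {α : Type*} [MeasurableSpace α] {n m k : ℕ}
    {f : α → Matrix (Fin n) (Fin m) ℝ} {g : α → Matrix (Fin m) (Fin k) ℝ}
    (hf : Measurable f) (hg : Measurable g) : Measurable fun a ↦ f a * g a := by
  rw [measurable_matrix_iff] at *
  intro i j
  simp only [Matrix.mul_apply]
  exact Finset.measurable_sum _ fun l _ ↦ (hf i l).mul (hg l j)

/-- The matrix whose entries are the coordinates of a Euclidean vector. -/
def matrixOfEuclidean (n k : ℕ) :
    EuclideanSpace ℝ (Fin n × Fin k) ≃ₗ[ℝ] Matrix (Fin n) (Fin k) ℝ where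
  toFun x := Matrix.of fun i j ↦ x (i, j)
  invFun A := WithLp.toLp 2 fun p ↦ A p.1 p.2
  map_add' _ _ := rfl
  map_smul' _ _ := rfl
  left_inv _ := rfl
  right_inv _ := rfl

theorem measurable_matrixOfEuclidean (n k : ℕ) : Measurable (matrixOfEuclidean n k) := by
  rw [measurable_matrix_iff]
  intro i j
  change Measurable fun x : EuclideanSpace ℝ (Fin n × Fin k) ↦ x (i, j)
  fun_prop

theorem norm_sq_matrixOfEuclidean_symm {n k : ℕ} (A : Matrix (Fin n) (Fin k) ℝ) :
    ‖(matrixOfEuclidean n k).symm A‖ ^ 2 = (Aᵀ * A).trace := by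
  rw [EuclideanSpace.real_norm_sq_eq, Fintype.sum_prod_type, Finset.sum_comm]
  simp only [Matrix.trace, Matrix.diag, Matrix.mul_apply, Matrix.transpose_apply, sq]
  rfl

theorem map_matrixOfEuclidean_stdGaussian (n k : ℕ) :
    (stdGaussian (EuclideanSpace ℝ (Fin n × Fin k))).map (matrixOfEuclidean n k) =
      gaussianMatrix n k := by
  rw [← map_pi_eq_stdGaussian, Measure.map_map (measurable_matrixOfEuclidean n k) (by fun_prop)]
  have := Measure.infinitePi_map_curry (fun (_ : Fin n) (_ : Fin k) ↦ gaussianReal 0 1)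
  simp only [Measure.infinitePi_eq_pi] at this
  exact this

theorem gaussianMatrix_map_linear {n k n' k' : ℕ} (hdim : n * k = n' * k')
    (T : Matrix (Fin n) (Fin k) ℝ →ₗ[ℝ] Matrix (Fin n') (Fin k') ℝ)
    (hT : ∀ A, ((T A)ᵀ * T A).trace = (Aᵀ * A).trace) :
    (gaussianMatrix n k).map T = gaussianMatrix n' k' := by
  let L : EuclideanSpace ℝ (Fin n × Fin k) →ₗᵢ[ℝ] EuclideanSpace ℝ (Fin n' × Fin k') :=
    { toLinearMap := (matrixOfEuclidean n' k').symm.toLinearMap ∘ₗ T ∘ₗ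
        (matrixOfEuclidean n k).toLinearMap
      norm_map' := fun x ↦ by
        have := norm_sq_matrixOfEuclidean_symm (T (matrixOfEuclidean n k x))
        rw [hT, ← norm_sq_matrixOfEuclidean_symm, LinearEquiv.symm_apply_apply] at this
        exact (sq_eq_sq₀ (norm_nonneg _) (norm_nonneg _)).1 this }
  let e := L.toLinearIsometryEquiv (by simp [hdim])
  have hTm : Measurable T := by
    have h1 : Measurable (L ∘ fun A : Matrix (Fin n) (Fin k) ℝ ↦
        (matrixOfEuclidean n k).symm A) := by
      refine L.continuous.measurable.comp ?_
      change Measurable fun A : Matrix (Fin n) (Fin k) ℝ ↦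
        WithLp.toLp 2 fun p : Fin n × Fin k ↦ A p.1 p.2
      refine (WithLp.measurable_toLp _ _).comp (measurable_pi_lambda _ fun p ↦ ?_)
      exact measurable_matrix_entry p.1 p.2
    have h2 := (measurable_matrixOfEuclidean n' k').comp h1
    convert h2 using 1
    ext1 A
    simp [L]
  rw [← map_matrixOfEuclidean_stdGaussian, ← map_matrixOfEuclidean_stdGaussian,
    ← stdGaussian_map e, Measure.map_map hTm (measurable_matrixOfEuclidean n k),
    Measure.map_map (measurable_matrixOfEuclidean n' k') e.continuous.measurable]
  congr 1

theorem gaussianMatrix_map_transpose (n k : ℕ) :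
    (gaussianMatrix n k).map (fun A ↦ Aᵀ) = gaussianMatrix k n :=
  gaussianMatrix_map_linear (mul_comm n k) (Matrix.transposeLinearEquiv _ _ ℝ ℝ).toLinearMap
    fun A ↦ Matrix.trace_mul_comm A Aᵀ

theorem gaussianMatrix_map_mul_left {n k : ℕ} {U : Matrix (Fin n) (Fin n) ℝ}
    (hU : Uᵀ * U = 1) : (gaussianMatrix n k).map (fun A ↦ U * A) = gaussianMatrix n k :=
  gaussianMatrix_map_linear rfl (mulLeftLinearMap _ ℝ U) fun A ↦ by
    simp only [mulLeftLinearMap_apply, Matrix.transpose_mul]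
    rw [Matrix.mul_assoc, ← Matrix.mul_assoc Uᵀ, hU, Matrix.one_mul]

/-- Replacing one coordinate of a product-distributed vector by an independent copy does not
change the law. -/
theorem map_update_pi_prod {ι X : Type*} [Fintype ι] [DecidableEq ι] [MeasurableSpace X]
    (ν : Measure X) [IsProbabilityMeasure ν] (j : ι) :
    ((Measure.pi fun _ : ι ↦ ν).prod ν).map (fun p ↦ Function.update p.1 j p.2) =
      Measure.pi fun _ : ι ↦ ν := by
  have hm : Measurable fun p : (ι → X) × X ↦ Function.update p.1 j p.2 := by
    refine measurable_pi_lambda _ fun i ↦ ?_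
    by_cases h : i = j
    · subst h; simpa using measurable_snd
    · simpa [h] using! (measurable_pi_apply i).comp measurable_fst
  refine (Measure.pi_eq fun s hs ↦ ?_).symm
  rw [Measure.map_apply hm (MeasurableSet.univ_pi hs)]
  have : (fun p : (ι → X) × X ↦ Function.update p.1 j p.2) ⁻¹' Set.univ.pi s =
      Set.univ.pi (Function.update s j Set.univ) ×ˢ s j := by
    ext p
    simp only [Set.mem_preimage, Set.mem_univ_pi, Set.mem_prod]
    constructor
    · intro h
      refine ⟨fun i ↦ ?_, by simpa using h j⟩
      by_cases hi : i = j
      · subst hi; simp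
      · simpa [hi] using h i
    · rintro ⟨h, hj⟩ i
      by_cases hi : i = j
      · subst hi; simpa using hj
      · simpa [hi] using h i
  rw [this, Measure.prod_prod, Measure.pi_pi, ← Finset.prod_erase_mul _ _ (Finset.mem_univ j),
    ← Finset.prod_erase_mul Finset.univ (fun i ↦ ν (s i)) (Finset.mem_univ j)]
  simp only [Function.update_self, measure_univ, mul_one]
  congr 1
  refine Finset.prod_congr rfl fun i hi ↦ ?_
  rw [Function.update_of_ne (Finset.ne_of_mem_erase hi)]

end GaussianMatrix

section OrthogonalInvariance

instance (n k : ℕ) : BorelSpace (Matrix (Fin n) (Fin k) ℝ) :=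
  inferInstanceAs (BorelSpace (Fin n → Fin k → ℝ))

instance (n : ℕ) : CompactSpace (Matrix.orthogonalGroup (Fin n) ℝ) := by
  suffices IsCompact (Matrix.orthogonalGroup (Fin n) ℝ : Set (Matrix (Fin n) (Fin n) ℝ)) from
    isCompact_iff_compactSpace.1 this
  have hK : IsCompact (Set.univ.pi fun _ ↦ Set.univ.pi fun _ ↦ Set.Icc (-1) 1 :
      Set (Fin n → Fin n → ℝ)) :=
    isCompact_univ_pi fun _ ↦ isCompact_univ_pi fun _ ↦ isCompact_Icc
  refine hK.of_isClosed_subset (isClosed_unitary (R := Matrix (Fin n) (Fin n) ℝ)) ?_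
  intro U hU i _ j _
  have := entry_norm_bound_of_unitary hU i j
  rwa [Real.norm_eq_abs, abs_le] at this

/-- Two real matrices with the same Gram matrix differ by an orthogonal left factor. -/
theorem Matrix.exists_orthogonal_mul_eq {n k : ℕ} {A B : Matrix (Fin n) (Fin k) ℝ}
    (h : Aᵀ * A = Bᵀ * B) :
    ∃ W : Matrix (Fin n) (Fin n) ℝ, W ∈ Matrix.orthogonalGroup (Fin n) ℝ ∧ A = W * B := by
  let LA := Matrix.toLpLin 2 2 A
  let LB := Matrix.toLpLin 2 2 B
  have hsq : ∀ (M : Matrix (Fin n) (Fin k) ℝ) (x : EuclideanSpace ℝ (Fin k)),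
      ‖Matrix.toLpLin 2 2 M x‖ ^ 2 = x.ofLp ⬝ᵥ ((Mᵀ * M) *ᵥ x.ofLp) := by
    intro M x
    rw [EuclideanSpace.real_norm_sq_eq, ← Matrix.mulVec_mulVec, Matrix.dotProduct_mulVec,
      Matrix.vecMul_transpose]
    simp [dotProduct, sq, Matrix.toLpLin_apply]
  have hnorm : ∀ x, ‖LA x‖ = ‖LB x‖ := by
    intro x
    rw [← sq_eq_sq₀ (norm_nonneg _) (norm_nonneg _), hsq, hsq, h]
  obtain ⟨s, hs⟩ := LB.rangeRestrict.exists_rightInverse_of_surjective LB.range_rangeRestrict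
  have hs' : ∀ y : LinearMap.range LB, LB (s y) = y := fun y ↦
    congrArg Subtype.val (LinearMap.congr_fun hs y)
  let L : LinearMap.range LB →ₗᵢ[ℝ] EuclideanSpace ℝ (Fin n) :=
    { toLinearMap := LA ∘ₗ s
      norm_map' := fun y ↦ by
        rw [LinearMap.comp_apply, hnorm, hs', Submodule.coe_norm] }
  have hL : ∀ x, L ⟨LB x, LinearMap.mem_range_self LB x⟩ = LA x := by
    intro x
    have h0 : LA (s ⟨LB x, LinearMap.mem_range_self LB x⟩ - x) = 0 := by
      rw [← norm_eq_zero, hnorm, map_sub, hs', sub_self, norm_zero]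
    rw [map_sub, sub_eq_zero] at h0
    exact h0
  let V := L.extend
  let W : Matrix (Fin n) (Fin n) ℝ := (Matrix.toLpLin 2 2).symm V.toLinearMap
  have hW : ∀ x : EuclideanSpace ℝ (Fin n), W *ᵥ x.ofLp = (V x).ofLp := by
    intro x
    rw [← Matrix.toLin'_apply, ← Matrix.ofLp_toLpLin 2 2, LinearEquiv.apply_symm_apply]
    rfl
  refine ⟨W, ?_, ?_⟩
  · rw [Matrix.mem_orthogonalGroup_iff']
    ext i j
    have hcol : ∀ l i, W l i = V (EuclideanSpace.single i 1) l := by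
      intro l i
      rw [← hW]
      simp
    have hin := V.inner_map_map (EuclideanSpace.single j 1) (EuclideanSpace.single i 1)
    rw [PiLp.inner_apply] at hin
    simp only [Matrix.mul_apply, Matrix.transpose_apply, hcol]
    refine hin.trans ?_
    simp [EuclideanSpace.inner_single_left, Matrix.one_apply, eq_comm]
  · refine Matrix.ext_of_mulVec_single fun i ↦ ?_
    have h1 := hW (LB (EuclideanSpace.single i 1))
    rw [L.extend_apply ⟨LB (EuclideanSpace.single i 1), LinearMap.mem_range_self LB _⟩, hL] at h1
    rw [← Matrix.mulVec_mulVec]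
    exact h1.symm

variable {n k : ℕ}

theorem measurable_transpose_mul :
    Measurable fun p : Matrix (Fin n) (Fin k) ℝ × Matrix.orthogonalGroup (Fin n) ℝ ↦
      (p.2 : Matrix (Fin n) (Fin n) ℝ)ᵀ * p.1 := by
  refine Measurable.matrix_mul (measurable_matrix_iff.2 fun i j ↦ ?_) measurable_fst
  exact (measurable_matrix_entry j i).comp (measurable_subtype_coe.comp measurable_snd)

theorem lintegral_eq_lintegral_haar {ν : Measure (Matrix (Fin n) (Fin k) ℝ)}
    [IsProbabilityMeasure ν]
    (hν : ∀ U : Matrix (Fin n) (Fin n) ℝ, Uᵀ * U = 1 → ν.map (fun Q => U * Q) = ν)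
    (h : Measure (Matrix.orthogonalGroup (Fin n) ℝ)) [IsProbabilityMeasure h]
    {f : Matrix (Fin n) (Fin k) ℝ → ENNReal} (hf : Measurable f) :
    ∫⁻ M, f M ∂ν = ∫⁻ M, ∫⁻ U, f ((U : Matrix (Fin n) (Fin n) ℝ)ᵀ * M) ∂h ∂ν := by
  rw [lintegral_lintegral_swap (f := fun M (U : Matrix.orthogonalGroup (Fin n) ℝ) ↦
    f ((U : Matrix (Fin n) (Fin n) ℝ)ᵀ * M)) (hf.comp measurable_transpose_mul).aemeasurable]
  have hU : ∀ U : Matrix.orthogonalGroup (Fin n) ℝ,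
      ∫⁻ M, f ((U : Matrix (Fin n) (Fin n) ℝ)ᵀ * M) ∂ν = ∫⁻ M, f M ∂ν := by
    intro U
    have h1 := hν (U : Matrix (Fin n) (Fin n) ℝ)ᵀ (by
      rw [Matrix.transpose_transpose]
      exact (mem_orthogonalGroup_iff _ _).1 U.2)
    conv_rhs => rw [← h1]
    rw [lintegral_map hf]
    exact Measurable.matrix_mul measurable_const measurable_id
  simp [hU]

/-- Two random matrices with left-invariant laws and the same Gram matrix have the same law. -/
theorem map_eq_map_of_gram_eq {Ω : Type*} [MeasurableSpace Ω] {P : Measure Ω}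
    [IsProbabilityMeasure P] {A B : Ω → Matrix (Fin n) (Fin k) ℝ}
    (hA : Measurable A) (hB : Measurable B)
    (hAinv : ∀ U : Matrix (Fin n) (Fin n) ℝ, Uᵀ * U = 1 →
      (P.map A).map (fun Q => U * Q) = P.map A)
    (hBinv : ∀ U : Matrix (Fin n) (Fin n) ℝ, Uᵀ * U = 1 →
      (P.map B).map (fun Q => U * Q) = P.map B)
    (hgram : ∀ᵐ ω ∂P, (A ω)ᵀ * A ω = (B ω)ᵀ * B ω) : P.map A = P.map B := by
  have := Measure.isProbabilityMeasure_map (μ := P) hA.aemeasurable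
  have := Measure.isProbabilityMeasure_map (μ := P) hB.aemeasurable
  let h : Measure (Matrix.orthogonalGroup (Fin n) ℝ) := Measure.haarMeasure ⊤
  have hh : IsProbabilityMeasure h := ⟨Measure.haarMeasure_self⟩
  refine Measure.ext_of_lintegral _ fun f hf ↦ ?_
  have hFm : Measurable fun M : Matrix (Fin n) (Fin k) ℝ ↦
      ∫⁻ U, f ((U : Matrix (Fin n) (Fin n) ℝ)ᵀ * M) ∂h :=
    (hf.comp measurable_transpose_mul).lintegral_prod_right'
  rw [lintegral_eq_lintegral_haar hAinv h hf, lintegral_eq_lintegral_haar hBinv h hf,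
    lintegral_map hFm hA, lintegral_map hFm hB]
  refine lintegral_congr_ae ?_
  filter_upwards [hgram] with ω hω
  obtain ⟨W, hW, hWA⟩ := Matrix.exists_orthogonal_mul_eq hω
  rw [hWA, ← lintegral_mul_left_eq_self _ (⟨W, hW⟩ : Matrix.orthogonalGroup (Fin n) ℝ)]
  refine lintegral_congr fun U ↦ ?_
  rw [Submonoid.coe_mul, Matrix.transpose_mul, Matrix.mul_assoc, ← Matrix.mul_assoc Wᵀ,
    (mem_orthogonalGroup_iff' _ _).1 hW, Matrix.one_mul]

end OrthogonalInvariance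

section GramSchmidt

open InnerProductSpace

variable {E : Type*} [NormedAddCommGroup E] [InnerProductSpace ℝ E]

theorem inner_gramSchmidt_self {k : ℕ} (f : Fin k → E) (j : Fin k) :
    inner ℝ (gramSchmidt ℝ f j) (f j) = ‖gramSchmidt ℝ f j‖ ^ 2 := by
  conv_lhs => rw [gramSchmidt_def'' ℝ f j]
  rw [inner_add_right, inner_sum, real_inner_self_eq_norm_sq, Finset.sum_eq_zero, add_zero]
  intro i hi
  rw [inner_smul_right, gramSchmidt_orthogonal ℝ f (Finset.mem_Iio.1 hi).ne', mul_zero]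

theorem inner_gramSchmidtNormed_self {k : ℕ} (f : Fin k → E) (j : Fin k) :
    inner ℝ (gramSchmidtNormed ℝ f j) (f j) = ‖gramSchmidt ℝ f j‖ := by
  rw [gramSchmidtNormed, inner_smul_left, inner_gramSchmidt_self]
  simp only [RCLike.ofReal_real_eq_id, id_eq, conj_trivial]
  by_cases h : ‖gramSchmidt ℝ f j‖ = 0
  · simp [h]
  · field_simp

theorem sum_inner_gramSchmidtNormed_smul {k : ℕ} (f : Fin k → E) (j : Fin k) :
    ∑ i, inner ℝ (gramSchmidtNormed ℝ f i) (f j) • gramSchmidtNormed ℝ f i = f j := by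
  have hsmul : ∀ i, inner ℝ (gramSchmidtNormed ℝ f i) (f j) • gramSchmidtNormed ℝ f i =
      (inner ℝ (gramSchmidt ℝ f i) (f j) / ‖gramSchmidt ℝ f i‖ ^ 2) • gramSchmidt ℝ f i := by
    intro i
    rw [gramSchmidtNormed, inner_smul_left, smul_smul]
    congr 1
    simp only [RCLike.ofReal_real_eq_id, id_eq, conj_trivial]
    rw [div_eq_mul_inv, ← inv_pow]
    ring
  simp_rw [hsmul]
  conv_rhs => rw [gramSchmidt_def'' ℝ f j]
  have hins : Finset.Iic j = insert j (Finset.Iio j) := by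
    ext i; simp [le_iff_eq_or_lt]
  rw [← Finset.sum_subset (Finset.subset_univ (Finset.Iic j)), hins, Finset.sum_insert (by simp)]
  · congr 1
    rw [inner_gramSchmidt_self]
    by_cases h : gramSchmidt ℝ f j = 0
    · simp [h]
    · rw [div_self (by simpa using h), one_smul]
  · intro i _ hi
    rw [gramSchmidt_inv_triangular ℝ f (by simpa using hi), zero_div, zero_smul]

theorem sum_inner_gramSchmidtNormed_mul {k : ℕ} (f : Fin k → E) (a b : Fin k) :
    ∑ i, inner ℝ (gramSchmidtNormed ℝ f i) (f a) * inner ℝ (gramSchmidtNormed ℝ f i) (f b) =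
      inner ℝ (f a) (f b) := by
  conv_rhs => rw [← sum_inner_gramSchmidtNormed_smul f a]
  rw [sum_inner]
  simp [inner_smul_left]

theorem norm_gramSchmidt_le {k : ℕ} (f : Fin k → E) (j : Fin k) :
    ‖gramSchmidt ℝ f j‖ ≤ ‖f j‖ := by
  rcases (norm_nonneg (gramSchmidt ℝ f j)).eq_or_lt with h | h
  · rw [← h]; exact norm_nonneg _
  · have := real_inner_le_norm (gramSchmidt ℝ f j) (f j)
    rw [inner_gramSchmidt_self] at this
    nlinarith

theorem norm_orthogonalProjectionOnto_le_norm_gramSchmidt {k : ℕ} (f : Fin k → E) (j : Fin k)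
    (W : Submodule ℝ E) [W.HasOrthogonalProjection]
    (hW : ∀ l < j, f l ∈ Wᗮ) :
    ‖W.orthogonalProjectionOnto (f j)‖ ≤ ‖gramSchmidt ℝ f j‖ := by
  have hsub : f j - gramSchmidt ℝ f j ∈ Wᗮ := by
    have hspan : Submodule.span ℝ (f '' Set.Iio j) ≤ Wᗮ := by
      rw [Submodule.span_le]
      rintro _ ⟨l, hl, rfl⟩
      exact hW l hl
    refine hspan ?_
    rw [← span_gramSchmidt_Iio ℝ f j]
    conv in f j - _ => rw [gramSchmidt_def'' ℝ f j]
    rw [add_sub_cancel_left]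
    refine Submodule.sum_mem _ fun i hi ↦ Submodule.smul_mem _ _ (Submodule.subset_span ?_)
    exact Set.mem_image_of_mem _ (Finset.mem_Iio.1 hi)
  have h := W.orthogonalProjectionOnto_eq_zero_iff.2 hsub
  rw [map_sub, sub_eq_zero] at h
  rw [h]
  exact W.norm_orthogonalProjectionOnto_apply_le _

theorem Submodule.exists_le_finrank_eq [FiniteDimensional ℝ E] (V : Submodule ℝ E) {m : ℕ}
    (hm : m ≤ Module.finrank ℝ V) : ∃ W ≤ V, Module.finrank ℝ W = m := by
  obtain ⟨v, hv⟩ := exists_linearIndependent_of_le_finrank hm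
  refine ⟨Submodule.span ℝ (Set.range (V.subtype ∘ v)), ?_, ?_⟩
  · rw [Submodule.span_le]
    rintro _ ⟨i, rfl⟩
    exact (v i).2
  · rw [finrank_span_eq_card (hv.map' V.subtype V.ker_subtype), Fintype.card_fin]

variable [FiniteDimensional ℝ E] [MeasurableSpace E] [BorelSpace E]

theorem measurable_gramSchmidt {α : Type*} [MeasurableSpace α] {k : ℕ} {F : α → Fin k → E}
    (hF : ∀ j, Measurable fun a ↦ F a j) (j : Fin k) :
    Measurable fun a ↦ gramSchmidt ℝ (F a) j := by
  induction j using WellFoundedLT.induction with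
  | ind j ih =>
    have : (fun a ↦ gramSchmidt ℝ (F a) j) = fun a ↦ F a j - ∑ i ∈ Finset.Iio j,
        (inner ℝ (gramSchmidt ℝ (F a) i) (F a j) / ‖gramSchmidt ℝ (F a) i‖ ^ 2) •
          gramSchmidt ℝ (F a) i := by
      ext a
      conv_rhs => enter [1]; rw [gramSchmidt_def'' ℝ (F a) j]
      simp
    rw [this]
    refine (hF j).sub (Finset.measurable_fun_sum _ fun i hi ↦ ?_)
    have hi' := ih i (Finset.mem_Iio.1 hi)
    exact ((hi'.inner (hF j)).div (hi'.norm.pow_const 2)).smul hi'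

theorem measurable_inner_gramSchmidtNormed {α : Type*} [MeasurableSpace α] {k : ℕ}
    {F : α → Fin k → E} (hF : ∀ j, Measurable fun a ↦ F a j) (i j : Fin k) :
    Measurable fun a ↦ inner ℝ (gramSchmidtNormed ℝ (F a) i) (F a j) := by
  have h := measurable_gramSchmidt hF i
  exact (h.norm.inv.smul h).inner (hF j)

theorem integrable_norm_gramSchmidt_pi {k : ℕ} (j : Fin k) :
    Integrable (fun f : Fin k → E ↦ ‖gramSchmidt ℝ f j‖)
      (Measure.pi fun _ : Fin k ↦ stdGaussian E) := by
  have hid : Integrable (fun x : E ↦ ‖x‖) (stdGaussian E) :=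
    (IsGaussian.integrable_id).norm
  have h : Integrable (fun f : Fin k → E ↦ ‖f j‖) (Measure.pi fun _ : Fin k ↦ stdGaussian E) :=
    (measurePreserving_eval (fun _ : Fin k ↦ stdGaussian E) j).integrable_comp_of_integrable hid
  refine h.mono' (measurable_gramSchmidt (fun j ↦ measurable_pi_apply j) j).norm.aestronglyMeasurable
    (ae_of_all _ fun f ↦ ?_)
  rw [norm_norm]
  exact norm_gramSchmidt_le f j

theorem chiSqrtMoment_le_integral_norm_gramSchmidt {k : ℕ} (hk : k ≤ Module.finrank ℝ E)
    (j : Fin k) :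
    chiSqrtMoment ((Module.finrank ℝ E : ℝ) - j) ≤
      ∫ f : Fin k → E, ‖gramSchmidt ℝ f j‖ ∂(Measure.pi fun _ : Fin k ↦ stdGaussian E) := by
  set ν := stdGaussian E
  have hint := integrable_norm_gramSchmidt_pi (E := E) j
  have hmeas : Measurable fun p : (Fin k → E) × E ↦ Function.update p.1 j p.2 := by
    refine measurable_pi_lambda _ fun i ↦ ?_
    by_cases h : i = j
    · subst h; simpa using measurable_snd
    · simpa [h] using! (measurable_pi_apply i).comp measurable_fst
  have hmp : MeasurePreserving (fun p : (Fin k → E) × E ↦ Function.update p.1 j p.2)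
      ((Measure.pi fun _ : Fin k ↦ ν).prod ν) (Measure.pi fun _ : Fin k ↦ ν) :=
    ⟨hmeas, map_update_pi_prod ν j⟩
  have hint' := hmp.integrable_comp_of_integrable hint
  have heq : ∫ f : Fin k → E, ‖gramSchmidt ℝ f j‖ ∂(Measure.pi fun _ : Fin k ↦ ν) =
      ∫ f, ∫ x, ‖gramSchmidt ℝ (Function.update f j x) j‖ ∂ν ∂(Measure.pi fun _ : Fin k ↦ ν) := by
    conv_lhs => rw [← hmp.map_eq]
    rw [integral_map hmeas.aemeasurable (by rw [hmp.map_eq]; exact hint.aestronglyMeasurable)]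
    exact integral_prod _ hint'
  rw [heq]
  have hconst : chiSqrtMoment ((Module.finrank ℝ E : ℝ) - j) =
      ∫ _ : Fin k → E, chiSqrtMoment ((Module.finrank ℝ E : ℝ) - j)
        ∂(Measure.pi fun _ : Fin k ↦ ν) := by simp
  rw [hconst]
  refine integral_mono_ae (integrable_const _) hint'.integral_prod_left ?_
  filter_upwards [hint'.prod_right_ae] with f hf
  set S := Submodule.span ℝ (f '' Set.Iio j)
  have hS : Module.finrank ℝ S ≤ j := by
    classical
    have h := finrank_span_finset_le_card (R := ℝ) ((Finset.Iio j).image f)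
    rw [Finset.coe_image, Finset.coe_Iio] at h
    refine (h.trans Finset.card_image_le).trans ?_
    simp
  have hSo := S.finrank_add_finrank_orthogonal
  have hj := j.2
  obtain ⟨W, hWS, hW⟩ := Submodule.exists_le_finrank_eq Sᗮ
    (m := Module.finrank ℝ E - j) (by omega)
  have hcast : ((Module.finrank ℝ W : ℕ) : ℝ) = (Module.finrank ℝ E : ℝ) - j := by
    rw [hW, Nat.cast_sub (by omega)]
  rw [← hcast, ← integral_norm_orthogonalProjection_stdGaussian W (by omega)]
  refine integral_mono_ae ?_ hf (ae_of_all _ fun x ↦ ?_)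
  · exact (W.orthogonalProjectionOnto.integrable_comp IsGaussian.integrable_id).norm
  · have := norm_orthogonalProjectionOnto_le_norm_gramSchmidt (Function.update f j x) j W ?_
    · simpa using this
    · intro l hl
      rw [Function.update_of_ne hl.ne]
      refine Submodule.orthogonal_le hWS ?_
      exact Submodule.le_orthogonal_orthogonal _ (Submodule.subset_span (Set.mem_image_of_mem _ hl))

end GramSchmidt

section SignedShift

/-- The orthogonal matrix `e_b ↦ ε_b e_{b + c}`. -/
def signedShift {k : ℕ} [NeZero k] (ε : Fin k → ℤˣ) (c : Fin k) : Matrix (Fin k) (Fin k) ℝ :=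
  Matrix.of fun a b ↦ if a = b + c then ((ε b : ℤ) : ℝ) else 0

theorem transpose_signedShift_mul_mul {k : ℕ} [NeZero k] (ε : Fin k → ℤˣ) (c : Fin k)
    (R : Matrix (Fin k) (Fin k) ℝ) (i j : Fin k) :
    ((signedShift ε c)ᵀ * R * signedShift ε c) i j =
      ((ε i : ℤ) : ℝ) * ((ε j : ℤ) : ℝ) * R (i + c) (j + c) := by
  simp [Matrix.mul_apply, signedShift]
  ring

theorem Int.units_coe_mul_self_real (u : ℤˣ) : ((u : ℤ) : ℝ) * ((u : ℤ) : ℝ) = 1 := by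
  rcases Int.units_eq_one_or u with rfl | rfl <;> simp

theorem transpose_signedShift_mul_self {k : ℕ} [NeZero k] (ε : Fin k → ℤˣ) (c : Fin k) :
    (signedShift ε c)ᵀ * signedShift ε c = 1 := by
  ext i j
  have := transpose_signedShift_mul_mul ε c 1 i j
  rw [Matrix.mul_one] at this
  rw [this]
  by_cases h : i = j
  · subst h; simp [Int.units_coe_mul_self_real]
  · simp [h]

theorem sum_units_mul_eq_zero {k : ℕ} {i j : Fin k} (hij : i ≠ j) :
    ∑ ε : Fin k → ℤˣ, ((ε i : ℤ) : ℝ) * ((ε j : ℤ) : ℝ) = 0 := by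
  have h := Equiv.sum_comp (Equiv.mulRight (Pi.mulSingle i (-1) : Fin k → ℤˣ))
    fun ε : Fin k → ℤˣ ↦ ((ε i : ℤ) : ℝ) * ((ε j : ℤ) : ℝ)
  simp only [Equiv.coe_mulRight, Pi.mul_apply, Pi.mulSingle_eq_same,
    Pi.mulSingle_eq_of_ne hij.symm, mul_one, Units.val_neg,
    Int.cast_neg, mul_neg, neg_mul, Finset.sum_neg_distrib] at h
  linarith

theorem sum_transpose_signedShift_mul_mul {k : ℕ} [NeZero k] (R : Matrix (Fin k) (Fin k) ℝ) :
    ∑ p : (Fin k → ℤˣ) × Fin k, (signedShift p.1 p.2)ᵀ * R * signedShift p.1 p.2 =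
      (Fintype.card (Fin k → ℤˣ) * R.trace) • (1 : Matrix (Fin k) (Fin k) ℝ) := by
  ext i j
  rw [Matrix.sum_apply, Fintype.sum_prod_type]
  simp only [transpose_signedShift_mul_mul, Matrix.smul_apply, smul_eq_mul]
  by_cases h : i = j
  · subst h
    simp only [Int.units_coe_mul_self_real, one_mul, Matrix.one_apply_eq, mul_one,
      Finset.sum_const, Finset.card_univ, nsmul_eq_mul]
    congr 1
    exact Equiv.sum_comp (Equiv.addLeft i) fun a ↦ R a a
  · rw [Finset.sum_comm]
    simp [← Finset.sum_mul, sum_units_mul_eq_zero h, h]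

end SignedShift

theorem ConcaveOn.exists_supergradient_nonpos_of_even {ψ : ℝ → ℝ}
    (hψ : ConcaveOn ℝ Set.univ ψ) (heven : ψ (-1) = ψ 1) :
    ∃ s ≤ 0, ∀ x, ψ x ≤ ψ 1 + s * (x - 1) := by
  have hφ := hψ.neg
  have hmem : ∀ x : ℝ, x ∈ interior (Set.univ : Set ℝ) := by simp
  set d := derivWithin (-ψ) (Set.Ioi 1) 1
  have hle : ∀ x, ψ x ≤ ψ 1 + -d * (x - 1) := by
    intro x
    rcases lt_trichotomy x 1 with hx | rfl | hx
    · have h := (hφ.slope_le_leftDeriv_of_mem_interior (Set.mem_univ x) (hmem 1) hx).trans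
        (hφ.leftDeriv_le_rightDeriv_of_mem_interior (hmem 1))
      rw [slope_def_field, div_le_iff₀ (by linarith)] at h
      simp only [Pi.neg_apply] at h
      linarith
    · simp
    · have h := hφ.rightDeriv_le_slope_of_mem_interior (hmem 1) (Set.mem_univ x) hx
      rw [slope_def_field, le_div_iff₀ (by linarith)] at h
      simp only [Pi.neg_apply] at h
      linarith
  refine ⟨-d, ?_, hle⟩
  have := hle (-1)
  linarith

theorem ConcaveOn.continuous_matrix {n k : ℕ} {g : Matrix (Fin n) (Fin k) ℝ → ℝ}
    (hg : ConcaveOn ℝ Set.univ g) : Continuous g := by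
  have h : ConcaveOn ℝ Set.univ (fun x : Fin n → Fin k → ℝ ↦ g x) := hg
  exact h.locallyLipschitz.continuous

theorem integrable_comp_smul_of_gram_eq_one {n k : ℕ}
    {μ : Measure (Matrix (Fin n) (Fin k) ℝ)} [IsProbabilityMeasure μ]
    (hμ : ∀ᵐ Q ∂μ, Qᵀ * Q = 1) {g : Matrix (Fin n) (Fin k) ℝ → ℝ} (hg : Continuous g) (c : ℝ) :
    Integrable (fun Q ↦ g (c • Q)) μ := by
  have hK : IsCompact (Set.univ.pi fun _ : Fin n ↦ Set.univ.pi fun _ : Fin k ↦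
      Set.Icc (-1 : ℝ) 1 : Set (Matrix (Fin n) (Fin k) ℝ)) :=
    isCompact_univ_pi fun _ ↦ isCompact_univ_pi fun _ ↦ isCompact_Icc
  have hcont : Continuous fun Q : Matrix (Fin n) (Fin k) ℝ ↦ g (c • Q) :=
    hg.comp (continuous_const_smul c)
  obtain ⟨C, hC⟩ := hK.exists_bound_of_continuousOn hcont.continuousOn
  refine Integrable.of_bound hcont.measurable.aestronglyMeasurable C ?_
  filter_upwards [hμ] with Q hQ
  refine hC Q fun i _ j _ ↦ ?_
  have h1 : ∑ l, Q l j * Q l j = 1 := by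
    have := congr_fun (congr_fun hQ j) j
    simpa [Matrix.mul_apply] using this
  have h2 : Q i j * Q i j ≤ 1 := h1 ▸
    Finset.single_le_sum (f := fun l ↦ Q l j * Q l j) (fun l _ ↦ mul_self_nonneg _)
      (Finset.mem_univ i)
  exact abs_le.1 (abs_le_one_iff_mul_self_le_one.2 h2)

theorem ConcaveOn.integral_comp_smul {n k : ℕ}
    {μ : Measure (Matrix (Fin n) (Fin k) ℝ)} {g : Matrix (Fin n) (Fin k) ℝ → ℝ}
    (hg : ConcaveOn ℝ Set.univ g) (hint : ∀ c : ℝ, Integrable (fun Q ↦ g (c • Q)) μ) :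
    ConcaveOn ℝ Set.univ fun c : ℝ ↦ ∫ Q, g (c • Q) ∂μ := by
  refine ⟨convex_univ, fun x _ y _ a b ha hb hab ↦ ?_⟩
  simp only [smul_eq_mul]
  rw [← integral_const_mul, ← integral_const_mul,
    ← integral_add ((hint x).const_mul a) ((hint y).const_mul b)]
  refine integral_mono (((hint x).const_mul a).add ((hint y).const_mul b)) (hint _) fun Q ↦ ?_
  have := hg.2 (Set.mem_univ (x • Q)) (Set.mem_univ (y • Q)) ha hb hab
  simpa [add_smul, mul_smul] using this

section TriangularFactor

open InnerProductSpace

/-- The columns of a matrix as Euclidean vectors. -/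
def matrixColumns {n k : ℕ} (A : Matrix (Fin n) (Fin k) ℝ) (j : Fin k) :
    EuclideanSpace ℝ (Fin n) :=
  WithLp.toLp 2 fun i ↦ A i j

/-- The triangular factor in the Gram–Schmidt (QR) decomposition of a matrix. -/
noncomputable def triangularFactor {n k : ℕ} (A : Matrix (Fin n) (Fin k) ℝ) :
    Matrix (Fin k) (Fin k) ℝ :=
  Matrix.of fun i j ↦
    inner ℝ (gramSchmidtNormed ℝ (matrixColumns A) i) (matrixColumns A j)

variable {n k : ℕ}

theorem measurable_matrixColumns (j : Fin k) :
    Measurable fun A : Matrix (Fin n) (Fin k) ℝ ↦ matrixColumns A j :=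
  (MeasurableEquiv.toLp 2 (Fin n → ℝ)).measurable.comp
    (measurable_pi_lambda _ fun i ↦ measurable_matrix_entry i j)

theorem measurable_triangularFactor :
    Measurable (triangularFactor : Matrix (Fin n) (Fin k) ℝ → Matrix (Fin k) (Fin k) ℝ) :=
  measurable_matrix_iff.2 fun i j ↦
    measurable_inner_gramSchmidtNormed measurable_matrixColumns i j

theorem transpose_triangularFactor_mul_self (A : Matrix (Fin n) (Fin k) ℝ) :
    (triangularFactor A)ᵀ * triangularFactor A = Aᵀ * A := by
  ext a b
  simp only [Matrix.mul_apply, Matrix.transpose_apply, triangularFactor, Matrix.of_apply]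
  rw [sum_inner_gramSchmidtNormed_mul]
  simp [matrixColumns, PiLp.inner_apply, mul_comm]

theorem trace_triangularFactor (A : Matrix (Fin n) (Fin k) ℝ) :
    (triangularFactor A).trace = ∑ j, ‖gramSchmidt ℝ (matrixColumns A) j‖ := by
  simp [Matrix.trace, triangularFactor, inner_gramSchmidtNormed_self]

theorem measurePreserving_matrixColumns :
    MeasurePreserving (matrixColumns : Matrix (Fin n) (Fin k) ℝ → _) (gaussianMatrix n k)
      (Measure.pi fun _ : Fin k ↦ stdGaussian (EuclideanSpace ℝ (Fin n))) := by
  refine ⟨measurable_pi_lambda _ measurable_matrixColumns, ?_⟩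
  have hcomp : (matrixColumns : Matrix (Fin n) (Fin k) ℝ → _) =
      (fun (B : Matrix (Fin k) (Fin n) ℝ) j ↦ WithLp.toLp 2 (B j)) ∘
        (fun A : Matrix (Fin n) (Fin k) ℝ ↦ Aᵀ) := rfl
  have hT : Measurable fun A : Matrix (Fin n) (Fin k) ℝ ↦ Aᵀ :=
    measurable_matrix_iff.2 fun i j ↦ measurable_matrix_entry j i
  have hL : Measurable fun (B : Matrix (Fin k) (Fin n) ℝ) j ↦
      (WithLp.toLp 2 (B j) : EuclideanSpace ℝ (Fin n)) :=
    measurable_pi_lambda _ fun j ↦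
      (MeasurableEquiv.toLp 2 (Fin n → ℝ)).measurable.comp (measurable_pi_apply j)
  have h := Measure.map_map (μ := gaussianMatrix n k) hL hT
  rw [gaussianMatrix_map_transpose] at h
  rw [hcomp]
  refine h.symm.trans ?_
  simp_rw [← map_pi_eq_stdGaussian]
  have : IsProbabilityMeasure
      ((Measure.pi fun _ : Fin n ↦ gaussianReal 0 1).map (WithLp.toLp 2)) := by
    rw [map_pi_eq_stdGaussian]; infer_instance
  exact Measure.pi_map_pi fun _ ↦
    (MeasurableEquiv.toLp 2 (Fin n → ℝ)).measurable.aemeasurable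

theorem integrable_norm_gramSchmidt_matrixColumns (j : Fin k) :
    Integrable (fun A : Matrix (Fin n) (Fin k) ℝ ↦ ‖gramSchmidt ℝ (matrixColumns A) j‖)
      (gaussianMatrix n k) :=
  measurePreserving_matrixColumns.integrable_comp_of_integrable (integrable_norm_gramSchmidt_pi j)

theorem integrable_trace_triangularFactor :
    Integrable (fun A ↦ (triangularFactor A).trace) (gaussianMatrix n k) := by
  simp_rw [trace_triangularFactor]
  exact integrable_finsetSum _ fun j _ ↦ integrable_norm_gramSchmidt_matrixColumns j

theorem sum_chiSqrtMoment_le_integral_trace (hkn : k ≤ n) :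
    ∑ i ∈ Finset.Icc 1 k, chiSqrtMoment ((n : ℝ) - (i : ℝ) + 1) ≤
      ∫ A, (triangularFactor A).trace ∂gaussianMatrix n k := by
  simp_rw [trace_triangularFactor]
  rw [integral_finsetSum _ fun j _ ↦ integrable_norm_gramSchmidt_matrixColumns j]
  have hsum : ∑ i ∈ Finset.Icc 1 k, chiSqrtMoment ((n : ℝ) - (i : ℝ) + 1) =
      ∑ j : Fin k, chiSqrtMoment ((n : ℝ) - j) := by
    rw [Fin.sum_univ_eq_sum_range fun j ↦ chiSqrtMoment ((n : ℝ) - j), Finset.range_eq_Ico,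
      Finset.sum_Ico_eq_sum_range, ← Finset.Ico_succ_right_eq_Icc, Finset.sum_Ico_eq_sum_range]
    refine Finset.sum_congr (by simp) fun j _ ↦ ?_
    congr 1
    push_cast
    ring
  rw [hsum]
  refine Finset.sum_le_sum fun j _ ↦ ?_
  have h := chiSqrtMoment_le_integral_norm_gramSchmidt (E := EuclideanSpace ℝ (Fin n)) (k := k)
    (by simpa using hkn) j
  rw [finrank_euclideanSpace_fin] at h
  refine h.trans_eq ?_
  rw [← measurePreserving_matrixColumns.map_eq,
    integral_map measurePreserving_matrixColumns.aemeasurable]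
  rw [measurePreserving_matrixColumns.map_eq]
  exact (integrable_norm_gramSchmidt_pi j).aestronglyMeasurable

end TriangularFactor

section Comparison

variable {n k : ℕ}

theorem gaussianMatrix_map_mul_right {O : Matrix (Fin k) (Fin k) ℝ} (hO : Oᵀ * O = 1) :
    (gaussianMatrix n k).map (fun A ↦ A * O) = gaussianMatrix n k :=
  gaussianMatrix_map_linear rfl (mulRightLinearMap _ ℝ O) fun A ↦ by
    simp only [mulRightLinearMap_apply, Matrix.transpose_mul]
    rw [Matrix.mul_assoc, Matrix.trace_mul_comm, Matrix.mul_assoc, Matrix.mul_assoc,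
      mul_eq_one_comm.1 hO, Matrix.mul_one]

/-- Multiplying a Haar-distributed Stiefel matrix by an independent copy of an orthogonal conjugate
of the triangular factor of a Gaussian matrix produces a Gaussian matrix. -/
theorem measurePreserving_mul_triangularFactor
    {μ : Measure (Matrix (Fin n) (Fin k) ℝ)} [IsProbabilityMeasure μ]
    (hμ_stiefel : ∀ᵐ Q ∂μ, Qᵀ * Q = 1)
    (hμ_inv : ∀ U : Matrix (Fin n) (Fin n) ℝ, Uᵀ * U = 1 → μ.map (fun Q ↦ U * Q) = μ)
    {O : Matrix (Fin k) (Fin k) ℝ} (hO : Oᵀ * O = 1) :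
    MeasurePreserving (fun p : Matrix (Fin n) (Fin k) ℝ × Matrix (Fin n) (Fin k) ℝ ↦
        p.2 * (Oᵀ * triangularFactor p.1 * O)) ((gaussianMatrix n k).prod μ)
      (gaussianMatrix n k) := by
  have hO' : O * Oᵀ = 1 := mul_eq_one_comm.1 hO
  have hB : Measurable fun p : Matrix (Fin n) (Fin k) ℝ × Matrix (Fin n) (Fin k) ℝ ↦
      p.2 * (Oᵀ * triangularFactor p.1 * O) :=
    measurable_snd.matrix_mul ((measurable_const.matrix_mul
      (measurable_triangularFactor.comp measurable_fst)).matrix_mul measurable_const)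
  have hA : Measurable fun p : Matrix (Fin n) (Fin k) ℝ × Matrix (Fin n) (Fin k) ℝ ↦
      p.1 * O := measurable_fst.matrix_mul measurable_const
  have hAlaw : ((gaussianMatrix n k).prod μ).map (fun p ↦ p.1 * O) = gaussianMatrix n k := by
    have h := Measure.map_map (μ := (gaussianMatrix n k).prod μ) (g := fun A ↦ A * O)
      (measurable_id.matrix_mul measurable_const) measurable_fst
    rw [Measure.map_fst_prod, measure_univ (μ := μ), one_smul, gaussianMatrix_map_mul_right hO] at h
    exact h.symm
  refine ⟨hB, ?_⟩
  refine Eq.trans ?_ hAlaw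
  refine (map_eq_map_of_gram_eq (P := (gaussianMatrix n k).prod μ) hA hB ?_ ?_ ?_).symm
  · intro U hU
    rw [hAlaw, gaussianMatrix_map_mul_left hU]
  · intro U hU
    have hUm : Measurable fun Q : Matrix (Fin n) (Fin k) ℝ ↦ U * Q :=
      measurable_const.matrix_mul measurable_id
    have hprod : ((gaussianMatrix n k).prod μ).map (Prod.map id fun Q ↦ U * Q) =
        (gaussianMatrix n k).prod μ := by
      rw [← Measure.map_prod_map _ _ measurable_id hUm, Measure.map_id, hμ_inv U hU]
    rw [Measure.map_map hUm hB]
    conv_rhs => rw [← hprod, Measure.map_map hB (measurable_id.prodMap hUm)]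
    congr 1
    ext1 p
    simp [Matrix.mul_assoc]
  · have hae : ∀ᵐ p ∂(gaussianMatrix n k).prod μ, p.2ᵀ * p.2 = (1 : Matrix (Fin k) (Fin k) ℝ) :=
      (Measure.quasiMeasurePreserving_snd (μ := gaussianMatrix n k) (ν := μ)).ae hμ_stiefel
    filter_upwards [hae] with p hp
    simp only [Matrix.transpose_mul, Matrix.transpose_transpose]
    have h1 : ∀ X : Matrix (Fin k) (Fin k) ℝ, p.2ᵀ * (p.2 * X) = X := fun X ↦ by
      rw [← Matrix.mul_assoc, hp, Matrix.one_mul]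
    have h2 : ∀ X : Matrix (Fin k) (Fin k) ℝ, O * (Oᵀ * X) = X := fun X ↦ by
      rw [← Matrix.mul_assoc, hO', Matrix.one_mul]
    have h3 : ∀ X : Matrix (Fin k) (Fin k) ℝ,
        (triangularFactor p.1)ᵀ * (triangularFactor p.1 * X) = p.1ᵀ * (p.1 * X) := fun X ↦ by
      rw [← Matrix.mul_assoc, transpose_triangularFactor_mul_self, Matrix.mul_assoc]
    simp only [Matrix.mul_assoc, h1, h2, h3]

theorem average_mul_conj_le [NeZero k] {g : Matrix (Fin n) (Fin k) ℝ → ℝ}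
    (hg : ConcaveOn ℝ Set.univ g) (a : ℝ) (Q : Matrix (Fin n) (Fin k) ℝ)
    (R : Matrix (Fin k) (Fin k) ℝ) :
    ∑ p : (Fin k → ℤˣ) × Fin k, (Fintype.card ((Fin k → ℤˣ) × Fin k) : ℝ)⁻¹ *
        g (a • (Q * ((signedShift p.1 p.2)ᵀ * R * signedShift p.1 p.2))) ≤
      g ((a * (R.trace / k)) • Q) := by
  have hN : (Fintype.card ((Fin k → ℤˣ) × Fin k) : ℝ) ≠ 0 := by
    exact_mod_cast Fintype.card_ne_zero
  refine (hg.le_map_sum (fun _ _ ↦ by positivity) ?_ fun _ _ ↦ Set.mem_univ _).trans_eq ?_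
  · rw [Finset.sum_const, Finset.card_univ, nsmul_eq_mul, mul_inv_cancel₀ hN]
  · congr 1
    rw [← Finset.smul_sum, ← Finset.smul_sum, ← Matrix.mul_sum,
      sum_transpose_signedShift_mul_mul, Matrix.mul_smul, Matrix.mul_one, smul_smul, smul_smul]
    congr 1
    rw [Fintype.card_prod, Fintype.card_fin] at hN ⊢
    push_cast at hN ⊢
    have := left_ne_zero_of_mul hN
    have := right_ne_zero_of_mul hN
    field_simp

theorem alphaConst_pos (hk : 0 < k) (hkn : k ≤ n) : 0 < alphaConst k n := by
  refine mul_pos (by positivity) (Finset.sum_pos (fun i hi ↦ chiSqrtMoment_pos ?_)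
    ⟨1, Finset.mem_Icc.2 ⟨le_rfl, hk⟩⟩)
  have : (i : ℝ) ≤ n := by exact_mod_cast (Finset.mem_Icc.1 hi).2.trans hkn
  linarith

end Comparison

/-- **Concave comparison principle.**  Let `k ≤ n`, let `μ` be the Haar probability measure
on the Stiefel manifold `V_k^n`, and let `γ` be the law of an `n × k` matrix with
independent `N(0,1)` entries.  For every concave `g`, `E g(Q) ≥ E g(α⁻¹ Γ)`. -/
theorem concave_comparison_principle
    (n k : ℕ) (hn : 0 < n) (hk : 0 < k) (hkn : k ≤ n)
    (μ : Measure (Matrix (Fin n) (Fin k) ℝ)) [IsProbabilityMeasure μ]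
    (hμ_stiefel : ∀ᵐ Q ∂μ, Qᵀ * Q = 1)
    (hμ_inv : ∀ U : Matrix (Fin n) (Fin n) ℝ, Uᵀ * U = 1 →
      μ.map (fun Q => U * Q) = μ)
    (γ : Measure (Matrix (Fin n) (Fin k) ℝ))
    (hγ : γ = Measure.pi fun _ : Fin n => Measure.pi fun _ : Fin k => gaussianReal 0 1)
    (g : Matrix (Fin n) (Fin k) ℝ → ℝ)
    (hg : ConcaveOn ℝ Set.univ g)
    (hint : Integrable (fun M => g ((alphaConst k n)⁻¹ • M)) γ) :
    ∫ M, g ((alphaConst k n)⁻¹ • M) ∂γ ≤ ∫ Q, g Q ∂μ := by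
  have : NeZero k := ⟨hk.ne'⟩
  obtain rfl : γ = gaussianMatrix n k := hγ
  set a := (alphaConst k n)⁻¹ with ha
  have hα := alphaConst_pos hk hkn
  set N := (Fintype.card ((Fin k → ℤˣ) × Fin k) : ℝ)
  have hN : N ≠ 0 := Nat.cast_ne_zero.2 Fintype.card_ne_zero
  have hψint := fun c ↦ integrable_comp_smul_of_gram_eq_one hμ_stiefel hg.continuous_matrix c
  set ψ : ℝ → ℝ := fun c ↦ ∫ Q, g (c • Q) ∂μ with hψ
  have heven : ψ (-1) = ψ 1 := by
    have hmap := hμ_inv (-1) (by simp)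
    have hm : Measurable fun Q : Matrix (Fin n) (Fin k) ℝ ↦ (-1 : Matrix (Fin n) (Fin n) ℝ) * Q :=
      measurable_const.matrix_mul measurable_id
    have h := integral_map (μ := μ) (f := g) hm.aemeasurable
      hg.continuous_matrix.measurable.aestronglyMeasurable
    rw [hmap] at h
    simpa [hψ] using h.symm
  obtain ⟨s, hs, hψs⟩ :=
    (hg.integral_comp_smul hψint).exists_supergradient_nonpos_of_even heven
  have hmp := fun p : (Fin k → ℤˣ) × Fin k ↦ measurePreserving_mul_triangularFactor
    hμ_stiefel hμ_inv (transpose_signedShift_mul_self p.1 p.2)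
  have hFint : ∀ p : (Fin k → ℤˣ) × Fin k, Integrable (fun ω ↦ N⁻¹ *
      g (a • (ω.2 * ((signedShift p.1 p.2)ᵀ * triangularFactor ω.1 * signedShift p.1 p.2))))
      ((gaussianMatrix n k).prod μ) :=
    fun p ↦ ((hmp p).integrable_comp_of_integrable hint).const_mul _
  have hFeq : ∀ p : (Fin k → ℤˣ) × Fin k, ∫ ω, g (a • (ω.2 *
      ((signedShift p.1 p.2)ᵀ * triangularFactor ω.1 * signedShift p.1 p.2))) ∂(gaussianMatrix n k).prod μ =
      ∫ M, g (a • M) ∂gaussianMatrix n k := by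
    intro p
    conv_rhs => rw [← (hmp p).map_eq]
    rw [integral_map (hmp p).aemeasurable]
    rw [(hmp p).map_eq]
    exact hint.aestronglyMeasurable
  set F : Matrix (Fin n) (Fin k) ℝ × Matrix (Fin n) (Fin k) ℝ → ℝ := fun ω ↦
    ∑ p : (Fin k → ℤˣ) × Fin k, N⁻¹ * g (a • (ω.2 * ((signedShift p.1 p.2)ᵀ *
      triangularFactor ω.1 * signedShift p.1 p.2))) with hF
  have hFi : Integrable F ((gaussianMatrix n k).prod μ) :=
    integrable_finsetSum _ fun p _ ↦ hFint p
  have hsum : ∫ M, g (a • M) ∂gaussianMatrix n k = ∫ ω, F ω ∂(gaussianMatrix n k).prod μ := by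
    rw [hF, integral_finsetSum _ fun p _ ↦ hFint p]
    simp_rw [integral_const_mul, hFeq]
    rw [Finset.sum_const, Finset.card_univ, nsmul_eq_mul, ← mul_assoc, mul_inv_cancel₀ hN, one_mul]
  have htr := integrable_trace_triangularFactor (n := n) (k := k)
  have hci : Integrable (fun A ↦ a * ((triangularFactor A).trace / k)) (gaussianMatrix n k) :=
    (htr.div_const _).const_mul _
  have hci' : Integrable (fun A ↦ s * (a * ((triangularFactor A).trace / k) - 1))
      (gaussianMatrix n k) := (hci.sub (integrable_const 1)).const_mul s
  have hc : 1 ≤ ∫ A, a * ((triangularFactor A).trace / k) ∂gaussianMatrix n k := by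
    rw [integral_const_mul, integral_div, ha, inv_mul_eq_div, one_le_div hα, alphaConst,
      one_div_mul_eq_div]
    gcongr
    exact sum_chiSqrtMoment_le_integral_trace hkn
  rw [hsum, integral_prod _ hFi]
  calc ∫ A, ∫ Q, F (A, Q) ∂μ ∂gaussianMatrix n k
      ≤ ∫ A, (ψ 1 + s * (a * ((triangularFactor A).trace / k) - 1)) ∂gaussianMatrix n k := by
        refine integral_mono_ae hFi.integral_prod_left
          ((integrable_const _).add hci') ?_
        filter_upwards [hFi.prod_right_ae] with A hA
        exact (integral_mono hA (hψint _) fun Q ↦ average_mul_conj_le hg a Q _).trans (hψs _)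
    _ = ψ 1 + s * (∫ A, a * ((triangularFactor A).trace / k) ∂gaussianMatrix n k - 1) := by
        rw [integral_add (integrable_const _) hci', integral_const_mul, integral_sub hci (integrable_const _)]
        simp
    _ ≤ ψ 1 := by nlinarith
    _ = ∫ Q, g Q ∂μ := by simp [hψ]
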